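/- For n → ∞, the roots p of the quantization condition sin((n+1)p)/sin(np) = −√2 in (0, π) have the asymptotic form p = lπ/n − lπ/((1+√2)n²) + O(1/n³) for l = 1, 2, …, and consequently the minimum spacing between consecutive eigenvalues 2cos p of the reduced glued-trees Hamiltonian is bounded below by 2π²/((1+√2)n³) + O(1/n⁴); in particular ΔE > 8/n³ for all sufficiently large n. -/

import Mathlib

/-- The reduced glued-trees Hamiltonian: the `2n × 2n` tridiagonal matrix with
off-diagonal entries `1` except for a `√2` entry between positions `n` and `n+1`. -/
noncomputable def reducedHamiltonian (n : ℕ) : Matrix (Fin (2 * n)) (Fin (2 * n)) ℝ :=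
  fun j k =>
    if j.val + 1 = k.val ∨ k.val + 1 = j.val then
      (if min j.val k.val = n - 1 then Real.sqrt 2 else 1) else 0

/-- The minimum gap between distinct eigenvalues of the reduced Hamiltonian. -/
noncomputable def minGap (n : ℕ) : ℝ :=
  sInf {d : ℝ | ∃ x ∈ spectrum ℝ (reducedHamiltonian n),
    ∃ y ∈ spectrum ℝ (reducedHamiltonian n), x ≠ y ∧ d = |x - y|}

/-- A quantization condition `sin ((n + 1) p) = s sin (n p)` with the sum formula expanded. -/
theorem sin_mul_cos_of_quantization {n s p : ℝ}
    (h : Real.sin ((n + 1) * p) = s * Real.sin (n * p)) :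
    Real.sin p * Real.cos (n * p) = Real.sin (n * p) * (s - Real.cos p) := by
  rw [add_mul, one_mul, Real.sin_add] at h
  linarith

theorem sin_sq_of_quantization {n s p : ℝ} (hs : s ^ 2 = 2)
    (h : Real.sin ((n + 1) * p) = s * Real.sin (n * p)) :
    Real.sin p ^ 2 = Real.sin (n * p) ^ 2 * (3 - 2 * s * Real.cos p) := by
  have h1 := sin_mul_cos_of_quantization h
  have h2 := Real.sin_sq_add_cos_sq p
  have h3 := Real.sin_sq_add_cos_sq (n * p)
  have h4 : Real.sin p ^ 2 * Real.cos (n * p) ^ 2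
      = Real.sin (n * p) ^ 2 * (s - Real.cos p) ^ 2 := by
    rw [← mul_pow, h1, mul_pow]
  linear_combination (-Real.sin p ^ 2) * h3 + h4 + Real.sin (n * p) ^ 2 * h2
    + Real.sin (n * p) ^ 2 * hs

theorem abs_le_of_sq_eq_two {s : ℝ} (hs : s ^ 2 = 2) : |s| ≤ 1.4143 :=
  abs_le_of_sq_le_sq (by norm_num [hs]) (by norm_num)

theorem le_abs_of_sq_eq_two {s : ℝ} (hs : s ^ 2 = 2) : 1.414 ≤ |s| := by
  have h := sq_abs s
  nlinarith [abs_nonneg s]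

/-- Every root of the quantization condition in `(0, π)` is at least `3π/(4n)`. -/
theorem le_mul_of_quantization {n s p : ℝ} (hn : 3 ≤ n) (hs : s ^ 2 = 2)
    (hp : 0 < p) (hp' : p < Real.pi) (h : Real.sin ((n + 1) * p) = s * Real.sin (n * p)) :
    3 * Real.pi / 4 ≤ n * p := by
  by_contra! hlt
  have hsin := Real.sin_pos_of_pos_of_lt_pi hp hp'
  have hA := sin_mul_cos_of_quantization h
  have hB := sin_sq_of_quantization hs h
  have hx : 0 < n * p := by positivity
  have hpi := Real.pi_pos
  have hhalf : 2 * Real.sin (n * p) ^ 2 ≤ 1 := by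
    have h1 : 2 * Real.sin p ^ 2 ≤ 3 - 2 * s * Real.cos p := by
      nlinarith [sq_nonneg (s * Real.cos p - 1), Real.sin_sq_add_cos_sq p]
    have h2 : Real.sin p ^ 2 * (2 * Real.sin (n * p) ^ 2) ≤ Real.sin p ^ 2 * 1 := by
      nlinarith [sq_nonneg (Real.sin (n * p))]
    exact le_of_mul_le_mul_left h2 (by positivity)
  have hquarter : n * p ≤ Real.pi / 4 := by
    by_contra! hgt
    have h1 := Real.cos_neg_of_pi_div_two_lt_of_lt (x := 2 * (n * p)) (by linarith) (by linarith)
    rw [Real.cos_two_mul'] at h1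
    nlinarith [Real.sin_sq_add_cos_sq (n * p)]
  have hcos : 0 < Real.cos (n * p) :=
    Real.cos_pos_of_mem_Ioo ⟨by linarith, by linarith⟩
  have hsinx : 0 < Real.sin (n * p) := Real.sin_pos_of_pos_of_lt_pi hx (by linarith)
  have htan := Real.lt_tan hx (by linarith)
  rw [Real.tan_eq_sin_div_cos, lt_div_iff₀ hcos] at htan
  have hs1 : Real.cos p < s := by
    have : 0 < Real.sin (n * p) * (s - Real.cos p) := by rw [← hA]; positivity
    linarith [pos_of_mul_pos_right this hsinx.le]
  have hs2 : 1.414 ≤ s := by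
    have h1 := le_abs_of_sq_eq_two hs
    rcases le_abs.mp h1 with h2 | h2
    · exact h2
    · linarith [Real.neg_one_le_cos p]
  have h5 : Real.sin (n * p) * 0.414 ≤ p * Real.cos (n * p) := by
    have h6 : Real.sin p * Real.cos (n * p) ≤ p * Real.cos (n * p) :=
      mul_le_mul_of_nonneg_right (Real.sin_lt hp).le hcos.le
    nlinarith [Real.cos_le_one p]
  have h7 : 0 < p * Real.cos (n * p) := by positivity
  nlinarith

/-- The reflection `p ↦ π - p` exchanges the two signs in the quantization condition. -/
theorem quantization_pi_sub {n : ℕ} {s p : ℝ}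
    (h : Real.sin (((n : ℝ) + 1) * p) = s * Real.sin (n * p)) :
    Real.sin (((n : ℝ) + 1) * (Real.pi - p)) = -s * Real.sin (n * (Real.pi - p)) := by
  have h1 := Real.sin_nat_mul_pi_sub ((n + 1) * p) (n + 1)
  have h2 := Real.sin_nat_mul_pi_sub (n * p) n
  push_cast at h1
  rw [mul_sub, mul_sub, h1, h2, h]
  ring

theorem le_sin_of_mem_Icc {n x : ℝ} (hn : 100 ≤ n) (h : 3 * Real.pi / 4 ≤ n * x)
    (h' : 3 * Real.pi / 4 ≤ n * (Real.pi - x)) : 2.33 / n ≤ Real.sin x := by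
  have hn0 : 0 < n := by linarith
  have hpi := Real.pi_gt_d2
  have ht : 0 < 2.35 / n := by positivity
  have htn : 2.35 / n ≤ 0.0235 := by rw [div_le_iff₀ hn0]; linarith
  have h1 : 2.35 / n ≤ x := by rw [div_le_iff₀ hn0]; nlinarith
  have h2 : 2.35 / n ≤ Real.pi - x := by rw [div_le_iff₀ hn0]; nlinarith
  have h3 : Real.sin (2.35 / n) ≤ Real.sin x := by
    rcases le_total x (Real.pi / 2) with hx | hx
    · exact Real.sin_le_sin_of_le_of_le_pi_div_two (by linarith) hx h1
    · rw [← Real.sin_pi_sub x]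
      exact Real.sin_le_sin_of_le_of_le_pi_div_two (by linarith) (by linarith) h2
  refine le_trans ?_ ((Real.sin_gt_sub_cube ht).le.trans h3)
  have h4 : 2.33 / n = 2.33 / 2.35 * (2.35 / n) := by field_simp
  rw [h4]
  nlinarith [mul_pos ht ht]

theorem abs_sin_sub_sin_le (x y : ℝ) : |Real.sin x - Real.sin y| ≤ |x - y| := by
  simpa [Real.dist_eq] using Real.lipschitzWith_sin.dist_le_mul x y

/-- The difference of the phases `n p` and `n q` of two quantization roots. -/
theorem sin_sub_of_quantization {n s t p q : ℝ}
    (hp : Real.sin ((n + 1) * p) = s * Real.sin (n * p))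
    (hq : Real.sin ((n + 1) * q) = t * Real.sin (n * q)) :
    Real.sin (n * (q - p)) * (Real.sin p * Real.sin q) =
      Real.sin (n * p) * Real.sin (n * q)
        * (s * Real.sin q - t * Real.sin p - Real.sin (q - p)) := by
  rw [mul_sub, Real.sin_sub, Real.sin_sub]
  linear_combination (Real.sin (n * q) * Real.sin q) * sin_mul_cos_of_quantization hp
    - (Real.sin (n * p) * Real.sin p) * sin_mul_cos_of_quantization hq

/-- Two distinct roots with the same sign are at least `1/n` apart. -/
theorem one_div_le_sub_of_same_sign {n s p q : ℝ} (hn : 100 ≤ n) (hs : s ^ 2 = 2)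
    (hp0 : 0 < p) (hpq : p < q) (hqpi : q < Real.pi)
    (hp : Real.sin ((n + 1) * p) = s * Real.sin (n * p))
    (hq : Real.sin ((n + 1) * q) = s * Real.sin (n * q)) : 1 / n ≤ q - p := by
  by_contra! hlt
  have hn0 : 0 < n := by linarith
  have hsp := Real.sin_pos_of_pos_of_lt_pi hp0 (hpq.trans hqpi)
  have hsq := Real.sin_pos_of_pos_of_lt_pi (hp0.trans hpq) hqpi
  have hsabs := abs_le_of_sq_eq_two hs
  have hδ : 0 < q - p := by linarith
  have hnδ : 0 < n * (q - p) := by positivity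
  have hnδ1 : n * (q - p) < 1 := by rwa [lt_div_iff₀ hn0, mul_comm] at hlt
  have hlow : 5 / 6 * (n * (q - p)) ≤ Real.sin (n * (q - p)) := by
    have := Real.sin_gt_sub_cube hnδ
    nlinarith [mul_pos hnδ hnδ]
  have hbound : ∀ x : ℝ, Real.sin ((n + 1) * x) = s * Real.sin (n * x) →
      0.17 * Real.sin (n * x) ^ 2 ≤ Real.sin x ^ 2 := by
    intro x hx
    rw [sin_sq_of_quantization hs hx]
    have h1 : s * Real.cos x ≤ 1.4143 := by
      refine (le_abs_self _).trans ?_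
      rw [abs_mul]
      nlinarith [Real.abs_cos_le_one x, abs_nonneg s, abs_nonneg (Real.cos x)]
    nlinarith [sq_nonneg (Real.sin (n * x))]
  have h1 := hbound p hp
  have h2 := hbound q hq
  have h3 : 0.17 * |Real.sin (n * p) * Real.sin (n * q)| ≤ Real.sin p * Real.sin q := by
    refine le_of_sq_le_sq ?_ (by positivity)
    rw [mul_pow, sq_abs, mul_pow, mul_pow]
    have := mul_le_mul h1 h2 (by positivity) (by positivity)
    linarith
  have h4 : |s * Real.sin q - s * Real.sin p - Real.sin (q - p)| ≤ 2.5 * (q - p) := by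
    have e1 := abs_sin_sub_sin_le q p
    rw [abs_of_pos hδ] at e1
    have e2 : |Real.sin (q - p)| ≤ q - p := by
      simpa [abs_of_pos hδ] using abs_sin_sub_sin_le (q - p) 0
    calc |s * Real.sin q - s * Real.sin p - Real.sin (q - p)|
        ≤ |s * (Real.sin q - Real.sin p)| + |Real.sin (q - p)| := by
          rw [mul_sub]; exact abs_sub _ _
      _ ≤ 1.4143 * (q - p) + (q - p) := by
          rw [abs_mul]; gcongr
      _ ≤ 2.5 * (q - p) := by linarith
  have h5 := congrArg abs (sin_sub_of_quantization hp hq)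
  rw [abs_mul, abs_mul _ (_ - _ - _), abs_of_pos (mul_pos hsp hsq),
    abs_of_nonneg (by linarith : 0 ≤ Real.sin (n * (q - p)))] at h5
  have hPP := mul_pos hsp hsq
  have h6 : 0.17 * Real.sin (n * (q - p)) * (Real.sin p * Real.sin q)
      ≤ 2.5 * (q - p) * (Real.sin p * Real.sin q) := by
    have := mul_le_mul h3 h4 (abs_nonneg _) hPP.le
    linarith
  have h7 := le_of_mul_le_mul_right h6 hPP
  nlinarith

/-- Two roots with opposite signs and less than `1/n` apart repel each other. -/
theorem sin_add_sin_le_of_opposite_sign {n s p q : ℝ} (hn : 100 ≤ n) (hs : s ^ 2 = 2)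
    (hp0 : 0 < p) (hpq : p < q) (hqpi : q < Real.pi) (hlt : q - p < 1 / n)
    (hp : Real.sin ((n + 1) * p) = s * Real.sin (n * p))
    (hq : Real.sin ((n + 1) * q) = -s * Real.sin (n * q)) :
    1.414 * (Real.sin p + Real.sin q) ≤ 3.11 * n * (q - p) := by
  have hn0 : 0 < n := by linarith
  have hsp := Real.sin_pos_of_pos_of_lt_pi hp0 (hpq.trans hqpi)
  have hsq := Real.sin_pos_of_pos_of_lt_pi (hp0.trans hpq) hqpi
  have hsabs := abs_le_of_sq_eq_two hs
  have hδ : 0 < q - p := by linarith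
  have hδ1 : q - p < 0.01 := by
    refine hlt.trans_le ?_
    rw [div_le_iff₀ hn0]; linarith
  have hM : (3 - 2 * s * Real.cos p) * (3 - 2 * (-s) * Real.cos q) ≤ 3.1 ^ 2 := by
    have e1 : |Real.cos q - Real.cos p| ≤ q - p := by
      simpa [Real.dist_eq, abs_of_pos hδ] using Real.lipschitzWith_cos.dist_le_mul q p
    have e2 : s * (Real.cos q - Real.cos p) ≤ 1.4143 * 0.01 := by
      refine (le_abs_self _).trans ?_
      rw [abs_mul]
      exact mul_le_mul hsabs (by linarith) (abs_nonneg _) (by norm_num)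
    have e3 : -(Real.cos p * Real.cos q) ≤ 0.0001 := by
      have := abs_le.mp e1
      nlinarith [sq_nonneg (Real.cos p + Real.cos q)]
    nlinarith
  have h3 : Real.sin p * Real.sin q ≤ 3.1 * |Real.sin (n * p) * Real.sin (n * q)| := by
    refine le_of_sq_le_sq ?_ (by positivity)
    rw [mul_pow, mul_pow, sq_abs, mul_pow, sin_sq_of_quantization hs hp,
      sin_sq_of_quantization (by rw [neg_sq, hs]) hq]
    have := mul_le_mul_of_nonneg_left hM
      (by positivity : 0 ≤ Real.sin (n * p) ^ 2 * Real.sin (n * q) ^ 2)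
    linarith
  have h4 : 1.414 * (Real.sin p + Real.sin q) - (q - p)
      ≤ |s * Real.sin q - -s * Real.sin p - Real.sin (q - p)| := by
    have e2 : |Real.sin (q - p)| ≤ q - p := by
      simpa [abs_of_pos hδ] using abs_sin_sub_sin_le (q - p) 0
    have e3 := le_abs_of_sq_eq_two hs
    calc 1.414 * (Real.sin p + Real.sin q) - (q - p)
        ≤ |s| * (Real.sin p + Real.sin q) - |Real.sin (q - p)| := by gcongr
      _ = |s * (Real.sin p + Real.sin q)| - |Real.sin (q - p)| := by
          rw [abs_mul, abs_of_pos (add_pos hsp hsq)]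
      _ ≤ |s * (Real.sin p + Real.sin q) - Real.sin (q - p)| := abs_sub_abs_le_abs_sub _ _
      _ = _ := by congr 1; ring
  have h5 := congrArg abs (sin_sub_of_quantization hp hq)
  have hPP := mul_pos hsp hsq
  rw [abs_mul, abs_mul _ (_ - _ - _), abs_of_pos hPP] at h5
  have h6 : |Real.sin (n * (q - p))| ≤ n * (q - p) := by
    simpa [abs_of_pos hδ, abs_of_pos hn0] using abs_sin_sub_sin_le (n * (q - p)) 0
  have h7 : (Real.sin p * Real.sin q) *
        |s * Real.sin q - -s * Real.sin p - Real.sin (q - p)|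
      ≤ (Real.sin p * Real.sin q) * (3.1 * |Real.sin (n * (q - p))|) := by
    have := mul_le_mul_of_nonneg_right h3
      (abs_nonneg (s * Real.sin q - -s * Real.sin p - Real.sin (q - p)))
    linarith
  have h8 := le_of_mul_le_mul_left h7 hPP
  nlinarith

/-- Distinct quantization roots of either sign have energies at least `9/n³` apart. -/
theorem cos_gap_of_quantization {n : ℕ} {s t p q : ℝ} (hn : 100 ≤ n)
    (hs : s ^ 2 = 2) (ht : t ^ 2 = 2)
    (hp0 : 0 < p) (hpq : p < q) (hqpi : q < Real.pi)
    (hp : Real.sin (((n : ℝ) + 1) * p) = s * Real.sin (n * p))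
    (hq : Real.sin (((n : ℝ) + 1) * q) = t * Real.sin (n * q)) :
    9 / (n : ℝ) ^ 3 ≤ 2 * Real.cos p - 2 * Real.cos q := by
  have hn' : (100 : ℝ) ≤ n := by exact_mod_cast hn
  have hn0 : (0 : ℝ) < n := by linarith
  have hδ : 0 < q - p := by linarith
  have hS : 2.33 / n ≤ Real.sin ((p + q) / 2) := by
    have e1 := le_mul_of_quantization (by linarith) hs hp0 (hpq.trans hqpi) hp
    have e2 := le_mul_of_quantization (by linarith) (s := -t) (p := Real.pi - q)
      (by rw [neg_sq, ht]) (by linarith) (by linarith) (quantization_pi_sub hq)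
    apply le_sin_of_mem_Icc hn' <;> nlinarith
  have hE : 2 * Real.cos p - 2 * Real.cos q
      = 4 * Real.sin ((p + q) / 2) * Real.sin ((q - p) / 2) := by
    have := Real.cos_sub_cos p q
    rw [show (p - q) / 2 = -((q - p) / 2) by ring, Real.sin_neg] at this
    linarith
  have hS0 : 0 < 2.33 / (n : ℝ) := by positivity
  rw [hE]
  rcases le_or_gt (1 / (n : ℝ)) (q - p) with hbig | hsmall
  · have h1 : 1 / (4 * n) ≤ Real.sin ((q - p) / 2) := by
      have e1 := Real.mul_le_sin (x := (q - p) / 2) (by linarith) (by linarith)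
      refine le_trans ?_ e1
      have e2 : 1 / 2 ≤ 2 / Real.pi := by
        rw [div_le_div_iff₀ (by norm_num) Real.pi_pos]; linarith [Real.pi_le_four]
      have e3 : 1 / (4 * n) = 1 / 2 * (1 / (n : ℝ) / 2) := by field_simp; norm_num
      rw [e3]
      gcongr
    calc 9 / (n : ℝ) ^ 3 ≤ 4 * (2.33 / n) * (1 / (4 * n)) := by
          field_simp; linarith
      _ ≤ _ := by gcongr; linarith
  · have hst : t = s ∨ t = -s := by
      rw [← sq_eq_sq_iff_eq_or_eq_neg, hs, ht]
    rcases hst with rfl | rfl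
    · linarith [one_div_le_sub_of_same_sign hn' hs hp0 hpq hqpi hp hq]
    have h1 := sin_add_sin_le_of_opposite_sign hn' hs hp0 hpq hqpi hsmall hp hq
    have h2 : Real.sin p + Real.sin q
        = 2 * Real.sin ((p + q) / 2) * Real.cos ((q - p) / 2) := by
      have e1 := Real.sin_add ((p + q) / 2) ((q - p) / 2)
      have e2 := Real.sin_sub ((p + q) / 2) ((q - p) / 2)
      rw [show (p + q) / 2 + (q - p) / 2 = q by ring] at e1
      rw [show (p + q) / 2 - (q - p) / 2 = p by ring] at e2
      linarith
    have hδ1 : q - p < 0.01 := by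
      refine hsmall.trans_le ?_
      rw [div_le_iff₀ hn0]; linarith
    have h3 : 0.99 ≤ Real.cos ((q - p) / 2) := by
      have := Real.one_sub_sq_div_two_le_cos (x := (q - p) / 2)
      nlinarith
    have h4 : 0.495 * (q - p) ≤ Real.sin ((q - p) / 2) := by
      have := Real.sin_gt_sub_cube (x := (q - p) / 2) (by linarith)
      nlinarith [mul_pos hδ hδ]
    generalize Real.sin ((p + q) / 2) = S at *
    have hS1 : 0 < S := hS0.trans_le hS
    have h5 : 0.9 * S / n ≤ q - p := by
      rw [h2] at h1
      rw [div_le_iff₀ hn0]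
      nlinarith
    calc 9 / (n : ℝ) ^ 3 ≤ 4 * (2.33 / n) * (0.495 * (0.9 * (2.33 / n) / n)) := by
          field_simp; norm_num
      _ ≤ 4 * S * (0.495 * (0.9 * S / n)) := by gcongr
      _ ≤ _ := by gcongr; exact le_trans (by gcongr) h4

/-- The solution of `u (k + 2) = E u (k + 1) - u k` with `u 0 = 0` and `u 1 = 1`. -/
def pathSolution (E : ℝ) : ℕ → ℝ
  | 0 => 0
  | 1 => 1
  | k + 2 => E * pathSolution E (k + 1) - pathSolution E k

theorem pathSolution_succ_succ (E : ℝ) (k : ℕ) :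
    pathSolution E (k + 2) = E * pathSolution E (k + 1) - pathSolution E k := rfl

theorem pathSolution_two_mul_cos (p : ℝ) (k : ℕ) :
    pathSolution (2 * Real.cos p) k * Real.sin p = Real.sin (k * p) := by
  induction k using Nat.twoStepInduction with
  | zero => simp [pathSolution]
  | one => simp [pathSolution]
  | more k ih1 ih2 =>
    rw [pathSolution_succ_succ, sub_mul, mul_assoc, ih2, ih1]
    push_cast
    have e1 := Real.sin_add ((k + 1) * p) p
    have e2 := Real.sin_sub ((k + 1) * p) p
    rw [show ((k : ℝ) + 1) * p + p = (k + 2) * p by ring] at e1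
    rw [show ((k : ℝ) + 1) * p - p = k * p by ring] at e2
    linarith

theorem pathSolution_neg_sq (E : ℝ) (k : ℕ) :
    pathSolution (-E) k ^ 2 = pathSolution E k ^ 2 := by
  have h : pathSolution (-E) k = (-1) ^ (k + 1) * pathSolution E k := by
    induction k using Nat.twoStepInduction with
    | zero => simp [pathSolution]
    | one => simp [pathSolution]
    | more k ih1 ih2 =>
      rw [pathSolution_succ_succ, pathSolution_succ_succ, ih1, ih2]
      ring
  rw [h, mul_pow, ← pow_mul, mul_comm (k + 1), pow_mul]
  simp

theorem pathSolution_invariant (E : ℝ) (k : ℕ) :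
    pathSolution E (k + 1) ^ 2 - E * pathSolution E (k + 1) * pathSolution E k
      + pathSolution E k ^ 2 = 1 := by
  induction k with
  | zero => simp [pathSolution]
  | succ k ih =>
    rw [pathSolution_succ_succ]
    linear_combination ih

theorem pathSolution_add_one_le {E : ℝ} (hE : 2 ≤ E) (k : ℕ) :
    (k : ℝ) ≤ pathSolution E k ∧ pathSolution E k + 1 ≤ pathSolution E (k + 1) := by
  induction k with
  | zero => simp [pathSolution]
  | succ k ih =>
    rw [pathSolution_succ_succ]
    have : (0 : ℝ) ≤ k := k.cast_nonneg
    push_cast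
    refine ⟨by linarith, ?_⟩
    nlinarith

theorem pathSolution_wronskian_pos {E F : ℝ} (hE : 2 ≤ E) (hEF : E < F) (k : ℕ) :
    0 < pathSolution F (k + 2) * pathSolution E (k + 1)
      - pathSolution E (k + 2) * pathSolution F (k + 1) := by
  have hpos : ∀ j : ℕ, 0 < pathSolution E (j + 1) * pathSolution F (j + 1) := by
    intro j
    have e1 := (pathSolution_add_one_le hE (j + 1)).1
    have e2 := (pathSolution_add_one_le (hE.trans hEF.le) (j + 1)).1
    have : (0 : ℝ) < (j + 1 : ℕ) := by positivity
    exact mul_pos (this.trans_le e1) (this.trans_le e2)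
  induction k with
  | zero => simp [pathSolution, hEF]
  | succ k ih =>
    rw [pathSolution_succ_succ F (k + 1), pathSolution_succ_succ E (k + 1)]
    nlinarith [mul_pos (sub_pos.mpr hEF) (hpos (k + 1))]

/-- For `E ≥ 2` the eigenvalue condition loses its sign ambiguity. -/
theorem pathSolution_succ_of_two_le {E : ℝ} {n : ℕ} (hE : 2 ≤ E)
    (h : pathSolution E (n + 1) ^ 2 = 2 * pathSolution E n ^ 2) :
    pathSolution E (n + 1) = Real.sqrt 2 * pathSolution E n := by
  have h1 := pathSolution_add_one_le hE n
  have h2 : (0 : ℝ) ≤ n := n.cast_nonneg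
  refine (sq_eq_sq₀ (by linarith) (mul_nonneg (by positivity) (by linarith))).mp ?_
  rw [h, mul_pow, Real.sq_sqrt zero_le_two]

theorem eigenvalue_unique_of_two_le {E F : ℝ} {n : ℕ} (hn : 1 ≤ n) (hE : 2 ≤ E) (hF : 2 ≤ F)
    (h : pathSolution E (n + 1) ^ 2 = 2 * pathSolution E n ^ 2)
    (h' : pathSolution F (n + 1) ^ 2 = 2 * pathSolution F n ^ 2) : E = F := by
  obtain ⟨k, rfl⟩ := Nat.exists_eq_add_of_le' hn
  have e1 := pathSolution_succ_of_two_le hE h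
  have e2 := pathSolution_succ_of_two_le hF h'
  rcases lt_trichotomy E F with hlt | heq | hlt
  · have := pathSolution_wronskian_pos hE hlt k
    rw [e1, e2] at this
    nlinarith
  · exact heq
  · have := pathSolution_wronskian_pos hF hlt k
    rw [e1, e2] at this
    nlinarith

/-- An eigenvalue which is at least `2` is bounded away from `2`. -/
theorem le_eigenvalue_of_two_le {E : ℝ} {n : ℕ} (hn : 100 ≤ n) (hE : 2 ≤ E)
    (h : pathSolution E (n + 1) ^ 2 = 2 * pathSolution E n ^ 2) : 2.05 ≤ E := by
  by_contra! hlt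
  have hn' : (100 : ℝ) ≤ n := by exact_mod_cast hn
  have e1 := pathSolution_succ_of_two_le hE h
  have e2 := pathSolution_invariant E n
  have e3 := (pathSolution_add_one_le hE n).1
  rw [h, e1] at e2
  have hs : Real.sqrt 2 < 1.415 := by
    rw [Real.sqrt_lt' (by norm_num)]; norm_num
  have hs' : E * Real.sqrt 2 ≤ 2.05 * 1.415 := by gcongr
  generalize pathSolution E n = w at *
  have hw : 100 ^ 2 ≤ w ^ 2 := by gcongr; linarith
  nlinarith

theorem reducedHamiltonian_isHermitian (n : ℕ) : (reducedHamiltonian n).IsHermitian := by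
  ext j k
  simp only [Matrix.conjTranspose_apply, reducedHamiltonian, star_trivial, min_comm k.val,
    or_comm (a := k.val + 1 = j.val)]

/-- The action of the reduced Hamiltonian on a function on `{1, …, 2n}` that is extended by zero:
the bond between the sites `n` and `n + 1` has weight `√2`. -/
theorem reducedHamiltonian_mulVec {n : ℕ} {v : Fin (2 * n) → ℝ} {f : ℕ → ℝ} (hf0 : f 0 = 0)
    (hf : ∀ j : Fin (2 * n), f (j + 1) = v j) (hf' : f (2 * n + 1) = 0) (j : Fin (2 * n)) :
    (reducedHamiltonian n).mulVec v j =
      (if (j : ℕ) = n then Real.sqrt 2 else 1) * f j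
        + (if (j : ℕ) + 1 = n then Real.sqrt 2 else 1) * f (j + 2) := by
  obtain ⟨j, hj⟩ := j
  have hsplit : ∀ i : ℕ,
      (if j + 1 = i ∨ i + 1 = j then (if min j i = n - 1 then Real.sqrt 2 else 1) else 0)
        * f (i + 1)
      = (if i = j + 1 then (if j + 1 = n then Real.sqrt 2 else 1) * f (j + 2) else 0)
        + (if i + 1 = j then (if j = n then Real.sqrt 2 else 1) * f j else 0) := by
    intro i
    grind
  simp only [Matrix.mulVec, dotProduct, reducedHamiltonian, ← hf]
  rw [Fin.sum_univ_eq_sum_range (fun i => (if j + 1 = i ∨ i + 1 = j then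
    (if min j i = n - 1 then Real.sqrt 2 else 1) else 0) * f (i + 1)) (2 * n)]
  simp only [hsplit]
  rw [Finset.sum_add_distrib, Finset.sum_ite_eq', add_comm]
  congr 1
  · rcases j with _ | j
    · simp [hf0]
    · simp only [Nat.add_right_cancel_iff]
      rw [Finset.sum_ite_eq', if_pos (by simp; omega)]
  · split_ifs with h1 h2 h2
    · rfl
    · rfl
    all_goals
      rw [Finset.mem_range] at h1
      rw [show j + 2 = 2 * n + 1 by omega, hf', mul_zero]

/-- Eigenvalues of the reduced Hamiltonian satisfy the squared quantization condition. -/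
theorem pathSolution_of_mem_spectrum {n : ℕ} (hn : 1 ≤ n) {E : ℝ}
    (hE : E ∈ spectrum ℝ (reducedHamiltonian n)) :
    pathSolution E (n + 1) ^ 2 = 2 * pathSolution E n ^ 2 := by
  have hH := reducedHamiltonian_isHermitian n
  rw [hH.spectrum_real_eq_range_eigenvalues] at hE
  obtain ⟨i, rfl⟩ := hE
  have hv := hH.mulVec_eigenvectorBasis i
  have hv0 : (⇑(hH.eigenvectorBasis i) : Fin (2 * n) → ℝ) ≠ 0 := by
    intro h
    exact hH.eigenvectorBasis.toBasis.ne_zero i (by ext k; simpa using congrFun h k)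
  generalize hH.eigenvalues i = E at *
  generalize (⇑(hH.eigenvectorBasis i) : Fin (2 * n) → ℝ) = v at *
  obtain ⟨f, hf0, hf, hf'⟩ : ∃ f : ℕ → ℝ, f 0 = 0 ∧ (∀ j : Fin (2 * n), f (j + 1) = v j) ∧
      f (2 * n + 1) = 0 :=
    ⟨fun k => if h : 1 ≤ k ∧ k ≤ 2 * n then v ⟨k - 1, by omega⟩ else 0, by simp,
      fun j => by simp, by simp⟩
  have hrec : ∀ j < 2 * n, (if j = n then Real.sqrt 2 else 1) * f j
      + (if j + 1 = n then Real.sqrt 2 else 1) * f (j + 2) = E * f (j + 1) := by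
    intro j hj
    have h1 := reducedHamiltonian_mulVec hf0 hf hf' ⟨j, hj⟩
    rw [hv] at h1
    have h2 := hf ⟨j, hj⟩
    simp only [Pi.smul_apply, smul_eq_mul, ← h2] at h1
    exact h1.symm
  have hleft : ∀ k, k + 1 ≤ n → f k = f 1 * pathSolution E k ∧
      f (k + 1) = f 1 * pathSolution E (k + 1) := by
    intro k
    induction k with
    | zero => simp [pathSolution, hf0]
    | succ k ih =>
      intro hk
      obtain ⟨h1, h2⟩ := ih (by omega)
      refine ⟨h2, ?_⟩
      have := hrec k (by omega)
      rw [if_neg (by omega), if_neg (by omega)] at this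
      rw [pathSolution_succ_succ]
      linear_combination this - h1 + E * h2
  have hright : ∀ k m, k + 1 ≤ n → m + k = 2 * n →
      f (m + 1) = f (2 * n) * pathSolution E k ∧
      f m = f (2 * n) * pathSolution E (k + 1) := by
    intro k
    induction k with
    | zero =>
      intro m _ hm
      rw [show m = 2 * n by omega]
      simp [pathSolution, hf']
    | succ k ih =>
      intro m hk hm
      obtain ⟨h1, h2⟩ := ih (m + 1) (by omega) (by omega)
      refine ⟨h2, ?_⟩
      have := hrec m (by omega)
      rw [if_neg (by omega), if_neg (by omega)] at this
      rw [pathSolution_succ_succ]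
      linear_combination this - h1 + E * h2
  obtain ⟨k, rfl⟩ := Nat.exists_eq_add_of_le' hn
  obtain ⟨l1, l2⟩ := hleft k le_rfl
  obtain ⟨r1, r2⟩ := hright k (k + 2) le_rfl (by omega)
  have c1 := hrec k (by omega)
  have c2 := hrec (k + 1) (by omega)
  rw [if_neg (by omega), if_pos rfl] at c1
  rw [if_pos rfl, if_neg (by omega)] at c2
  rw [show k + 1 + 2 = k + 2 + 1 by omega, show k + 1 + 1 = k + 2 by omega] at c2
  have hab : f 1 ≠ 0 ∨ f (2 * (k + 1)) ≠ 0 := by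
    by_contra! hcon
    refine hv0 (funext fun ⟨j, hj⟩ => ?_)
    have h1 := hf ⟨j, hj⟩
    dsimp only at h1
    rw [← h1, Pi.zero_apply]
    rcases le_or_gt (j + 1) (k + 1) with hle | hgt
    · rw [(hleft j hle).2, hcon.1, zero_mul]
    · rw [(hright (2 * (k + 1) - (j + 1)) (j + 1) (by omega) (by omega)).2, hcon.2, zero_mul]
  have hsqrt : Real.sqrt 2 ^ 2 = 2 := Real.sq_sqrt zero_le_two
  rw [l1, l2, r2] at c1
  rw [l2, r1, r2] at c2
  have d1 : f 1 * pathSolution E (k + 2)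
      = Real.sqrt 2 * (f (2 * (k + 1)) * pathSolution E (k + 1)) := by
    rw [pathSolution_succ_succ]; linear_combination -c1
  have d2 : f (2 * (k + 1)) * pathSolution E (k + 2)
      = Real.sqrt 2 * (f 1 * pathSolution E (k + 1)) := by
    rw [pathSolution_succ_succ]; linear_combination -c2
  show pathSolution E (k + 2) ^ 2 = _
  rcases hab with h | h
  · refine mul_left_cancel₀ h ?_
    linear_combination pathSolution E (k + 2) * d1 + Real.sqrt 2 * pathSolution E (k + 1) * d2
      + f 1 * pathSolution E (k + 1) ^ 2 * hsqrt
  · refine mul_left_cancel₀ h ?_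
    linear_combination pathSolution E (k + 2) * d2 + Real.sqrt 2 * pathSolution E (k + 1) * d1
      + f (2 * (k + 1)) * pathSolution E (k + 1) ^ 2 * hsqrt

theorem exists_ne_mem_spectrum {n : ℕ} (hn : 1 ≤ n) :
    ∃ x ∈ spectrum ℝ (reducedHamiltonian n), ∃ y ∈ spectrum ℝ (reducedHamiltonian n), x ≠ y := by
  by_contra! hcon
  have hH := reducedHamiltonian_isHermitian n
  let a : Fin (2 * n) := ⟨0, by omega⟩
  let b : Fin (2 * n) := ⟨1, by omega⟩
  have hall : ∀ i, hH.eigenvalues i = hH.eigenvalues a := fun i =>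
    hcon _ (hH.eigenvalues_mem_spectrum_real i) _ (hH.eigenvalues_mem_spectrum_real a)
  have htr := hH.trace_eq_sum_eigenvalues
  have htr0 : (reducedHamiltonian n).trace = 0 := by
    simp [Matrix.trace, reducedHamiltonian]
  simp only [htr0, hall] at htr
  have hzero : hH.eigenvalues a = 0 := by
    have : n ≠ 0 := by omega
    simpa [this, eq_comm] using htr
  have hH0 := hH.eigenvalues_eq_zero_iff.mp (funext fun i => (hall i).trans hzero)
  have hab := congrFun (congrFun hH0 a) b
  simp only [reducedHamiltonian, a, b, Matrix.zero_apply] at hab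
  simp at hab
  split_ifs at hab <;> simp at hab

/-- An eigenvalue in `(-2, 2)` is `2 cos p` for a root `p` of the quantization condition. -/
theorem exists_quantization_root {n : ℕ} {E : ℝ} (hE : -2 < E) (hE' : E < 2)
    (h : pathSolution E (n + 1) ^ 2 = 2 * pathSolution E n ^ 2) :
    ∃ p s : ℝ, 0 < p ∧ p < Real.pi ∧ s ^ 2 = 2 ∧ E = 2 * Real.cos p ∧
      Real.sin (((n : ℝ) + 1) * p) = s * Real.sin (n * p) := by
  have hcos : E = 2 * Real.cos (Real.arccos (E / 2)) := by
    rw [Real.cos_arccos (by linarith) (by linarith)]; ring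
  have hpos : 0 < Real.arccos (E / 2) := Real.arccos_pos.mpr (by linarith)
  have hlt : Real.arccos (E / 2) < Real.pi := by
    refine (Real.arccos_le_pi _).lt_of_ne fun hpi => ?_
    rw [Real.arccos_eq_pi] at hpi
    linarith
  generalize Real.arccos (E / 2) = p at *
  have e1 := pathSolution_two_mul_cos p n
  have e2 := pathSolution_two_mul_cos p (n + 1)
  rw [← hcos] at e1 e2
  push_cast at e2
  have hsqrt : Real.sqrt 2 ^ 2 = 2 := Real.sq_sqrt zero_le_two
  have hsq : pathSolution E (n + 1) ^ 2 = (Real.sqrt 2 * pathSolution E n) ^ 2 := by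
    rw [mul_pow, hsqrt, h]
  rcases sq_eq_sq_iff_eq_or_eq_neg.mp hsq with hs | hs
  · exact ⟨p, Real.sqrt 2, hpos, hlt, hsqrt, hcos, by rw [← e1, ← e2, hs]; ring⟩
  · exact ⟨p, -Real.sqrt 2, hpos, hlt, by rw [neg_sq, hsqrt], hcos, by
      rw [← e1, ← e2, hs]; ring⟩

theorem gap_of_pathSolution {n : ℕ} (hn : 100 ≤ n) {E F : ℝ} (hEF : E < F)
    (hE : pathSolution E (n + 1) ^ 2 = 2 * pathSolution E n ^ 2)
    (hF : pathSolution F (n + 1) ^ 2 = 2 * pathSolution F n ^ 2) :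
    9 / (n : ℝ) ^ 3 ≤ F - E := by
  have hn' : (100 : ℝ) ≤ n := by exact_mod_cast hn
  have hsmall : 9 / (n : ℝ) ^ 3 ≤ 0.05 := by
    have : (100 : ℝ) ^ 3 ≤ (n : ℝ) ^ 3 := by gcongr
    rw [div_le_iff₀ (by positivity)]
    linarith
  rcases le_or_gt 2 F with hF2 | hF2
  · rcases le_or_gt 2 E with hE2 | hE2
    · exact absurd (eigenvalue_unique_of_two_le (by omega) hE2 hF2 hE hF) hEF.ne
    · linarith [le_eigenvalue_of_two_le hn hF2 hF]
  rcases le_or_gt E (-2) with hE2 | hE2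
  · have hnegE : pathSolution (-E) (n + 1) ^ 2 = 2 * pathSolution (-E) n ^ 2 := by
      rw [pathSolution_neg_sq, pathSolution_neg_sq, hE]
    have hnegF : pathSolution (-F) (n + 1) ^ 2 = 2 * pathSolution (-F) n ^ 2 := by
      rw [pathSolution_neg_sq, pathSolution_neg_sq, hF]
    rcases le_or_gt F (-2) with hF3 | hF3
    · have := eigenvalue_unique_of_two_le (by omega) (by linarith) (by linarith) hnegE hnegF
      linarith
    · linarith [le_eigenvalue_of_two_le hn (by linarith) hnegE]
  obtain ⟨q, t, hq0, hqpi, ht, rfl, hq⟩ := exists_quantization_root hE2 (hEF.trans hF2) hE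
  obtain ⟨p, s, hp0, hppi, hs, rfl, hp⟩ := exists_quantization_root (hE2.trans hEF) hF2 hF
  have hpq : p < q := by
    by_contra! hle
    linarith [Real.cos_le_cos_of_nonneg_of_le_pi hq0.le hppi.le hle]
  exact cos_gap_of_quantization hn hs ht hp0 hpq hqpi hp hq

theorem le_minGap {n : ℕ} (hn : 100 ≤ n) : 9 / (n : ℝ) ^ 3 ≤ minGap n := by
  obtain ⟨x₀, hx₀, y₀, hy₀, hxy₀⟩ := exists_ne_mem_spectrum (n := n) (by omega)
  refine le_csInf ⟨_, x₀, hx₀, y₀, hy₀, hxy₀, rfl⟩ ?_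
  rintro d ⟨x, hx, y, hy, hxy, rfl⟩
  have hx' := pathSolution_of_mem_spectrum (by omega) hx
  have hy' := pathSolution_of_mem_spectrum (by omega) hy
  rcases lt_or_gt_of_ne hxy with hlt | hlt
  · rw [abs_sub_comm]
    exact (gap_of_pathSolution hn hlt hx' hy').trans (le_abs_self _)
  · exact (gap_of_pathSolution hn hlt hy' hx').trans (le_abs_self _)

/-- If `sin (p - θ) = √2 sin θ` with small `p`, then `θ ≈ p / (1 + √2)` to second order. -/
theorem abs_phase_sub_le {p θ : ℝ} (hp1 : p ≤ 1) (hθ : 0 < θ) (hθp : θ < p)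
    (h : Real.sin (p - θ) = Real.sqrt 2 * Real.sin θ) :
    |p / (1 + Real.sqrt 2) - θ| ≤ p ^ 2 := by
  have hs1 : 1 ≤ Real.sqrt 2 := by rw [Real.one_le_sqrt]; norm_num
  have hs2 : Real.sqrt 2 ≤ 2 := by rw [Real.sqrt_le_left] <;> norm_num
  have e1 := Real.sin_gt_sub_cube hθ
  have e2 := (Real.sin_lt hθ).le
  have e3 := Real.sin_gt_sub_cube (sub_pos.mpr hθp)
  have e4 := (Real.sin_lt (sub_pos.mpr hθp)).le
  have c1 : θ ^ 3 ≤ p ^ 2 := by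
    calc θ ^ 3 ≤ p ^ 3 := by gcongr
      _ ≤ p ^ 2 := pow_le_pow_of_le_one (by linarith) hp1 (by norm_num)
  have c2 : (p - θ) ^ 3 ≤ p ^ 2 := by
    calc (p - θ) ^ 3 ≤ p ^ 3 := by gcongr; linarith
      _ ≤ p ^ 2 := pow_le_pow_of_le_one (by linarith) hp1 (by norm_num)
  have hd : p / (1 + Real.sqrt 2) - θ = (p - (1 + Real.sqrt 2) * θ) / (1 + Real.sqrt 2) := by
    field_simp
  rw [hd, abs_div, abs_of_pos (by linarith : 0 < 1 + Real.sqrt 2), div_le_iff₀ (by linarith),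
    abs_le]
  have hp2 := sq_nonneg p
  have m1 := mul_le_mul_of_nonneg_left e1.le (Real.sqrt_nonneg 2)
  have m2 := mul_le_mul_of_nonneg_left e2 (Real.sqrt_nonneg 2)
  constructor <;> nlinarith

/-- For `1 ≤ l < n` there is a phase `θ` solving the quantization condition in `(0, lπ/n)`. -/
theorem exists_quantization_phase {n l : ℕ} (hl : 1 ≤ l) (hln : l < n) :
    ∃ p θ : ℝ, 0 < p ∧ p < Real.pi ∧ 0 < θ ∧ θ < Real.pi / 2 ∧ n * p = l * Real.pi - θ ∧
      Real.sin (p - θ) = Real.sqrt 2 * Real.sin θ := by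
  have hs1 : 1 < Real.sqrt 2 := by rw [Real.lt_sqrt] <;> norm_num
  have hden : ∀ x : ℝ, 0 < Real.sqrt 2 + Real.cos x := fun x => by
    linarith [Real.neg_one_le_cos x]
  have hl0 : (0 : ℝ) < l := by exact_mod_cast hl
  have hn0 : (0 : ℝ) < n := by exact_mod_cast hl.trans hln.le
  have hpi := Real.pi_pos
  let θ : ℝ → ℝ := fun x => Real.arctan (Real.sin x / (Real.sqrt 2 + Real.cos x))
  have hcont : Continuous fun x : ℝ => n * x + θ x := by
    refine (by fun_prop : Continuous fun x : ℝ => (n : ℝ) * x).add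
      (Real.continuous_arctan.comp (Continuous.div (by fun_prop) (by fun_prop) fun x => ?_))
    exact (hden x).ne'
  have hlt : (l : ℝ) * Real.pi / n < Real.pi := by
    rw [div_lt_iff₀ hn0, mul_comm]
    gcongr
  have hθ0 : ∀ x, 0 ≤ x → x ≤ Real.pi → 0 ≤ θ x := fun x hx hx' =>
    Real.arctan_nonneg.mpr (div_nonneg (Real.sin_nonneg_of_nonneg_of_le_pi hx hx') (hden x).le)
  have hx0 : 0 ≤ (l : ℝ) * Real.pi / n := by positivity
  obtain ⟨p, ⟨hp0, hpl⟩, hp⟩ := intermediate_value_Icc hx0 hcont.continuousOn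
    (show (l : ℝ) * Real.pi ∈ _ from
      ⟨by simp [θ]; positivity, by
        have := hθ0 _ hx0 hlt.le
        simp only [mul_div_cancel₀ _ hn0.ne']
        linarith⟩)
  simp only at hp
  have hp_pos : 0 < p := by
    refine hp0.lt_of_ne fun h => ?_
    rw [← h] at hp
    simp [θ] at hp
    omega
  have hp_lt : p < Real.pi := hpl.trans_lt hlt
  have hsin := Real.sin_pos_of_pos_of_lt_pi hp_pos hp_lt
  refine ⟨p, θ p, hp_pos, hp_lt, Real.arctan_pos.mpr (div_pos hsin (hden p)),
    Real.arctan_lt_pi_div_two _, by linarith, ?_⟩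
  have hcos : 0 < Real.cos (θ p) := Real.cos_arctan_pos _
  have htan : Real.tan (θ p) = Real.sin p / (Real.sqrt 2 + Real.cos p) := Real.tan_arctan _
  rw [Real.tan_eq_sin_div_cos, div_eq_div_iff hcos.ne' (hden p).ne'] at htan
  rw [Real.sin_sub]
  linarith

theorem quantization_roots_asymptotics {n l : ℕ} (hl : 1 ≤ l) (hln : 4 * l ≤ n) :
    ∃ p : ℝ, 0 < p ∧ p < Real.pi ∧ Real.sin ((n : ℝ) * p) ≠ 0 ∧
      Real.sin (((n : ℝ) + 1) * p) = -Real.sqrt 2 * Real.sin ((n : ℝ) * p) ∧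
      |p - ((l : ℝ) * Real.pi / n - (l : ℝ) * Real.pi / ((1 + Real.sqrt 2) * n ^ 2))|
        ≤ (((l : ℝ) * Real.pi) ^ 2 + l * Real.pi) / (n : ℝ) ^ 3 := by
  obtain ⟨p, θ, hp0, hppi, hθ0, hθ1, hnp, hphase⟩ :=
    exists_quantization_phase (n := n) hl (by omega)
  have hpi := Real.pi_pos
  have hl0 : (0 : ℝ) < l := by exact_mod_cast hl
  have hn0 : (0 : ℝ) < n := by exact_mod_cast (by omega : 0 < n)
  have hln' : 4 * (l : ℝ) ≤ n := by exact_mod_cast hln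
  have hs1 : 1 ≤ Real.sqrt 2 := by rw [Real.one_le_sqrt]; norm_num
  have hsinθ : 0 < Real.sin θ := Real.sin_pos_of_pos_of_lt_pi hθ0 (by linarith)
  have hsin_np : Real.sin (n * p) = -((-1) ^ l * Real.sin θ) := by
    rw [hnp, Real.sin_nat_mul_pi_sub]
  refine ⟨p, hp0, hppi, ?_, ?_, ?_⟩
  · rw [hsin_np]
    simp [hsinθ.ne']
  · rw [hsin_np, show ((n : ℝ) + 1) * p = l * Real.pi - (θ - p) by linarith,
      Real.sin_nat_mul_pi_sub, ← neg_sub p θ, Real.sin_neg, hphase]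
    ring
  · have hpn : p = (l * Real.pi - θ) / n := by rw [eq_div_iff hn0.ne']; linarith
    have hpl : p ≤ l * Real.pi / n := by rw [hpn]; gcongr; linarith
    have hp1 : p ≤ 1 := by
      refine hpl.trans ?_
      rw [div_le_one hn0]
      nlinarith [Real.pi_le_four]
    have hθp : θ < p := by
      by_contra! hle
      have : Real.sin (p - θ) ≤ 0 :=
        Real.sin_nonpos_of_nonpos_of_neg_pi_le (by linarith) (by linarith)
      have : 0 < Real.sqrt 2 * Real.sin θ := by positivity
      linarith
    have h1 := abs_phase_sub_le hp1 hθ0 hθp hphase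
    have h2 : |l * Real.pi / n / (1 + Real.sqrt 2) - θ|
        ≤ ((l * Real.pi) ^ 2 + l * Real.pi) / n ^ 2 := by
      have e1 : l * Real.pi / n / (1 + Real.sqrt 2) - θ
          = (p / (1 + Real.sqrt 2) - θ) + θ / (n * (1 + Real.sqrt 2)) := by
        rw [hpn]; field_simp; ring
      have e2 : θ / (n * (1 + Real.sqrt 2)) ≤ l * Real.pi / n ^ 2 := by
        calc θ / (n * (1 + Real.sqrt 2)) ≤ (l * Real.pi / n) / (n * 1) := by
              gcongr <;> linarith
          _ = l * Real.pi / n ^ 2 := by field_simp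
      have e3 : p ^ 2 ≤ (l * Real.pi) ^ 2 / n ^ 2 := by rw [← div_pow]; gcongr
      rw [e1, add_div]
      refine (abs_add_le _ _).trans ?_
      rw [abs_of_nonneg (by positivity : 0 ≤ θ / (n * (1 + Real.sqrt 2)))]
      linarith
    have h3 : p - (l * Real.pi / n - l * Real.pi / ((1 + Real.sqrt 2) * n ^ 2))
        = (l * Real.pi / n / (1 + Real.sqrt 2) - θ) / n := by
      rw [hpn]; field_simp; ring
    rw [h3, abs_div, abs_of_pos hn0, div_le_iff₀ hn0]
    refine h2.trans_eq ?_
    field_simp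

/-- Asymptotics of the quantization condition and the minimum eigenvalue gap: as
`n → ∞`, for each fixed `l ≥ 1` the quantization condition
`sin((n+1)p)/sin(np) = −√2` has a root `p = lπ/n − lπ/((1+√2)n²) + O(1/n³)` in
`(0, π)`, and the minimum spacing between consecutive eigenvalues `2 cos p` of the
reduced Hamiltonian is at least `2π²/((1+√2)n³) + O(1/n⁴)`; in particular
`ΔE > 8/n³` for all sufficiently large `n`. -/
theorem quantization_roots_and_min_gap :
    (∀ l : ℕ, 1 ≤ l → ∃ C > (0 : ℝ), ∀ᶠ n : ℕ in Filter.atTop, ∃ p : ℝ,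
        0 < p ∧ p < Real.pi ∧ Real.sin ((n : ℝ) * p) ≠ 0 ∧
        Real.sin (((n : ℝ) + 1) * p) = -Real.sqrt 2 * Real.sin ((n : ℝ) * p) ∧
        |p - ((l : ℝ) * Real.pi / n - (l : ℝ) * Real.pi / ((1 + Real.sqrt 2) * n ^ 2))|
          ≤ C / (n : ℝ) ^ 3)
    ∧ (∃ C > (0 : ℝ), ∀ᶠ n : ℕ in Filter.atTop,
        2 * Real.pi ^ 2 / ((1 + Real.sqrt 2) * (n : ℝ) ^ 3) - C / (n : ℝ) ^ 4 ≤ minGap n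
        ∧ 8 / (n : ℝ) ^ 3 < minGap n) := by
  refine ⟨fun l hl => ⟨((l : ℝ) * Real.pi) ^ 2 + l * Real.pi, ?_, ?_⟩, 1, one_pos, ?_⟩
  · have : (0 : ℝ) < l := by exact_mod_cast hl
    positivity
  · filter_upwards [Filter.eventually_ge_atTop (4 * l)] with n hn
    exact quantization_roots_asymptotics hl hn
  · filter_upwards [Filter.eventually_ge_atTop 100] with n hn
    have hn0 : (0 : ℝ) < n := by exact_mod_cast (by omega : 0 < n)
    have hgap := le_minGap hn
    refine ⟨le_trans ?_ hgap, lt_of_lt_of_le (by gcongr; norm_num) hgap⟩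
    have hs : 1.414 ≤ Real.sqrt 2 := by rw [Real.le_sqrt] <;> norm_num
    have hpi : Real.pi ^ 2 ≤ 3.15 ^ 2 := by gcongr; exact Real.pi_lt_d2.le
    have hC : 0 < 1 / (n : ℝ) ^ 4 := by positivity
    have hmain : 2 * Real.pi ^ 2 / ((1 + Real.sqrt 2) * (n : ℝ) ^ 3) ≤ 9 / (n : ℝ) ^ 3 := by
      rw [← div_div]
      gcongr
      rw [div_le_iff₀ (by linarith)]
      linarith
    linarith
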